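/- The number of isomorphism classes of indecomposable B(n)-modules is n + (n+1)². In particular, B(n) is of finite representation type. -/

import Mathlib

/-!  Representations of the quiver `Q(n)` with relations `I(n)`, i.e. modules
over the special biserial algebra `B(n) = k Q(n) / I(n)`.

`Q(n)` has vertices `0,…,n` and arrows `α i : i+1 → i`, `β i : i → i+1` for
`0 ≤ i ≤ n-1`; `I(n)` is generated by `β i α i - α (i+1) β (i+1)`,
`α i α (i+1)`, `β (i+1) β i` (for `0 ≤ i ≤ n-2`) and `α 0 β 0`.

A finite dimensional representation is described, after choosing bases, by its
dimension vector `d` and linear maps between the coordinate spaces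
`Fin (d i) → k` satisfying the relations.  (Vertices are indexed by `ℕ`, with
`d i = 0` for `i > n`.) -/

/-- A finite dimensional representation of `(Q(n), I(n))`, equivalently a
finite dimensional `B(n)`-module. -/
structure QRep (k : Type*) [Field k] (n : ℕ) where
  /-- the dimension vector -/
  d : ℕ → ℕ
  /-- only the vertices `0,…,n` carry a nonzero space -/
  hd : ∀ i, n < i → d i = 0
  /-- the map attached to the arrow `α i : i+1 → i` -/
  α : ∀ i : ℕ, (Fin (d (i + 1)) → k) →ₗ[k] (Fin (d i) → k)
  /-- the map attached to the arrow `β i : i → i+1` -/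
  β : ∀ i : ℕ, (Fin (d i) → k) →ₗ[k] (Fin (d (i + 1)) → k)
  /-- the binomial relations `β i α i = α (i+1) β (i+1)`, `0 ≤ i ≤ n-2` -/
  rel_comm : ∀ i, i + 2 ≤ n → (β i).comp (α i) = (α (i + 1)).comp (β (i + 1))
  /-- the relations `α i α (i+1) = 0`, `0 ≤ i ≤ n-2` -/
  rel_aa : ∀ i, i + 2 ≤ n → (α i).comp (α (i + 1)) = 0
  /-- the relations `β (i+1) β i = 0`, `0 ≤ i ≤ n-2` -/
  rel_bb : ∀ i, i + 2 ≤ n → (β (i + 1)).comp (β i) = 0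
  /-- the relation `α 0 β 0 = 0` -/
  rel_ab : (α 0).comp (β 0) = 0

/-- A homomorphism of representations of `(Q(n), I(n))`: a family of linear
maps commuting with the structure maps. -/
structure RepHom {k : Type*} [Field k] {n : ℕ} (M N : QRep k n) where
  f : ∀ i : ℕ, (Fin (M.d i) → k) →ₗ[k] (Fin (N.d i) → k)
  commα : ∀ i, (f i).comp (M.α i) = (N.α i).comp (f (i + 1))
  commβ : ∀ i, (f (i + 1)).comp (M.β i) = (N.β i).comp (f i)

/-- Two representations are isomorphic if there is a homomorphism all of whose
components are bijective. -/
def RepIso {k : Type*} [Field k] {n : ℕ} (M N : QRep k n) : Prop :=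
  ∃ φ : RepHom M N, ∀ i, Function.Bijective (φ.f i)

/-- A representation is indecomposable iff it is nonzero and its endomorphism
ring has no nontrivial idempotents. -/
def Indec {k : Type*} [Field k] {n : ℕ} (M : QRep k n) : Prop :=
  (∃ i, M.d i ≠ 0) ∧
    ∀ e : RepHom M M, (∀ i, (e.f i).comp (e.f i) = e.f i) →
      (∀ i, e.f i = 0) ∨ (∀ i, e.f i = LinearMap.id)

/-- A subrepresentation (submodule) of a representation `M`: a family of
subspaces invariant under all the structure maps. -/
structure SubRep {k : Type*} [Field k] {n : ℕ} (M : QRep k n) where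
  W : ∀ i : ℕ, Submodule k (Fin (M.d i) → k)
  mapα : ∀ i, (W (i + 1)).map (M.α i) ≤ W i
  mapβ : ∀ i, (W i).map (M.β i) ≤ W (i + 1)

/-- The dimension vector of a subrepresentation. -/
noncomputable def SubRep.dim {k : Type*} [Field k] {n : ℕ} {M : QRep k n} (N : SubRep M) (i : ℕ) : ℕ :=
  Module.finrank k (N.W i)

/-- The standard pairing `⟨v, d⟩ = ∑_{i=0}^{n} v i * d i` between a vector
`v ∈ ℝ^{n+1}` and a dimension vector `d`. -/
noncomputable def pairing (n : ℕ) (v : Fin (n + 1) → ℝ) (d : ℕ → ℕ) : ℝ :=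
  ∑ i : Fin (n + 1), v i * d i

/-- King's stability space `D(M) ⊆ ℝ^{n+1}` of a representation `M`: the set of
`v` with `⟨v, dim M⟩ = 0` and `⟨v, dim N⟩ ≤ 0` for every nonzero proper
subrepresentation `N` of `M`. -/
def StabSpace {k : Type*} [Field k] {n : ℕ} (M : QRep k n) : Set (Fin (n + 1) → ℝ) :=
  {v | pairing n v M.d = 0 ∧
    ∀ N : SubRep M, (∃ i, N.W i ≠ ⊥) → (∃ i, N.W i ≠ ⊤) →
      pairing n v N.dim ≤ 0}

namespace QRepAux

variable {k : Type*} [Field k] {n : ℕ}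

/-! ### Generalities -/

theorem vec_zero {m : ℕ} (h : m = 0) (v : Fin m → k) : v = 0 := by
  subst h; exact Subsingleton.elim _ _

theorem map_dom_zero {m m' : ℕ} (h : m = 0) (f : (Fin m → k) →ₗ[k] (Fin m' → k)) : f = 0 := by
  refine LinearMap.ext fun v => ?_
  rw [vec_zero h v]; simp

theorem aa (M : QRep k n) (i : ℕ) (v) : M.α i (M.α (i + 1) v) = 0 := by
  by_cases h : i + 2 ≤ n
  · exact LinearMap.congr_fun (M.rel_aa i h) v
  · rw [vec_zero (M.hd (i + 1 + 1) (by omega)) v]; simp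

theorem bb (M : QRep k n) (i : ℕ) (v) : M.β (i + 1) (M.β i v) = 0 := by
  by_cases h : i + 2 ≤ n
  · exact LinearMap.congr_fun (M.rel_bb i h) v
  · exact vec_zero (M.hd (i + 1 + 1) (by omega)) _

theorem cm (M : QRep k n) (i : ℕ) (h : i + 2 ≤ n) (v) :
    M.α (i + 1) (M.β (i + 1) v) = M.β i (M.α i v) :=
  (LinearMap.congr_fun (M.rel_comm i h) v).symm

theorem aba (M : QRep k n) (i : ℕ) (v) : M.α i (M.β i (M.α i v)) = 0 := by
  cases i with
  | zero => exact LinearMap.congr_fun M.rel_ab _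
  | succ i =>
    by_cases h : i + 2 ≤ n
    · rw [cm M i h, aa]; simp
    · rw [vec_zero (M.hd (i + 1 + 1) (by omega)) v]; simp

theorem bab (M : QRep k n) (i : ℕ) (v) : M.β i (M.α i (M.β i v)) = 0 := by
  cases i with
  | zero =>
    have := LinearMap.congr_fun M.rel_ab v
    simp only [LinearMap.comp_apply, LinearMap.zero_apply] at this
    rw [this]; simp
  | succ i =>
    by_cases h : i + 2 ≤ n
    · rw [cm M i h, bb]
    · exact vec_zero (M.hd (i + 1 + 1) (by omega)) _

theorem iso_dim {M N : QRep k n} (h : RepIso M N) (i : ℕ) : M.d i = N.d i := by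
  obtain ⟨φ, hφ⟩ := h
  have := (LinearEquiv.ofBijective (φ.f i) (hφ i)).finrank_eq
  simpa using this

/-! ### The projective-injective representations -/

/-- The homomorphism through the projective-injective at `q+1`. -/
theorem exists_hom (M N : QRep k n) (q : ℕ)
    (ψ : (Fin (M.d (q + 1)) → k) →ₗ[k] k) (x : Fin (N.d (q + 1)) → k) :
    ∃ φ : RepHom M N,
      (∀ m, φ.f q m = ψ (M.β q m) • N.α q x) ∧
      (∀ m, φ.f (q + 1) m = ψ (M.β q (M.α q m)) • x + ψ m • N.β q (N.α q x)) ∧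
      (∀ m, φ.f (q + 2) m = ψ (M.α (q + 1) m) • N.β (q + 1) x) ∧
      (∀ j, j ≠ q → j ≠ q + 1 → j ≠ q + 2 → φ.f j = 0) := by
  let A : (Fin (M.d q) → k) →ₗ[k] (Fin (N.d q) → k) := (ψ ∘ₗ M.β q).smulRight (N.α q x)
  let B : (Fin (M.d (q + 1)) → k) →ₗ[k] (Fin (N.d (q + 1)) → k) :=
    (ψ ∘ₗ M.β q ∘ₗ M.α q).smulRight x + ψ.smulRight (N.β q (N.α q x))
  let C : (Fin (M.d (q + 2)) → k) →ₗ[k] (Fin (N.d (q + 2)) → k) :=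
    (ψ ∘ₗ M.α (q + 1)).smulRight (N.β (q + 1) x)
  let F : ∀ i : ℕ, (Fin (M.d i) → k) →ₗ[k] (Fin (N.d i) → k) :=
    Function.update (Function.update (Function.update (fun _ => 0) q A) (q + 1) B) (q + 2) C
  have F0 : F q = A := by
    simp only [F]
    rw [Function.update_of_ne (by omega), Function.update_of_ne (by omega), Function.update_self]
  have F1 : F (q + 1) = B := by
    simp only [F]
    rw [Function.update_of_ne (by omega), Function.update_self]
  have F2 : F (q + 2) = C := by
    simp only [F]
    rw [Function.update_self]
  have F3 : ∀ j, j ≠ q → j ≠ q + 1 → j ≠ q + 2 → F j = 0 := by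
    intro j h0 h1 h2
    simp only [F]
    rw [Function.update_of_ne h2, Function.update_of_ne h1, Function.update_of_ne h0]
  have hA : ∀ m, A m = ψ (M.β q m) • N.α q x := fun m => rfl
  have hB : ∀ m, B m = ψ (M.β q (M.α q m)) • x + ψ m • N.β q (N.α q x) := fun m => rfl
  have hC : ∀ m, C m = ψ (M.α (q + 1) m) • N.β (q + 1) x := fun m => rfl
  clear_value A B C F
  refine ⟨⟨F, ?_, ?_⟩, ?_, ?_, ?_, ?_⟩
  · intro j
    refine LinearMap.ext fun m => ?_
    simp only [LinearMap.comp_apply]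
    by_cases h0 : j = q
    · subst h0
      rw [F0, F1, hA, hB]
      simp [aba]
    by_cases h1 : j = q + 1
    · subst h1
      rw [F1, F2, hB, hC, aa]
      by_cases h : q + 2 ≤ n
      · simp [cm N q h]
      · rw [vec_zero (M.hd (q + 1 + 1) (by omega)) m]; simp
    by_cases h2 : j = q + 2
    · subst h2
      rw [F2, F3 (q + 2 + 1) (by omega) (by omega) (by omega), hC]
      rw [aa]; simp
    by_cases h3 : j + 1 = q
    · subst h3
      rw [F3 j (by omega) (by omega) (by omega), F0, hA]
      simp [aa]
    rw [F3 j h0 h1 h2, F3 (j + 1) h3 (by omega) (by omega)]; simp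
  · intro j
    refine LinearMap.ext fun m => ?_
    simp only [LinearMap.comp_apply]
    by_cases h0 : j = q
    · subst h0
      rw [F0, F1, hA, hB, bab]
      simp
    by_cases h1 : j = q + 1
    · subst h1
      rw [F1, F2, hB, hC]
      by_cases h : q + 2 ≤ n
      · simp [cm M q h, bb]
      · exact (vec_zero (N.hd (q + 1 + 1) (by omega)) _).trans
          (vec_zero (N.hd (q + 1 + 1) (by omega)) _).symm
    by_cases h2 : j = q + 2
    · subst h2
      rw [F2, F3 (q + 2 + 1) (by omega) (by omega) (by omega), hC]
      simp [bb]
    by_cases h3 : j + 1 = q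
    · subst h3
      rw [F3 j (by omega) (by omega) (by omega), F0, hA, bb]
      simp
    rw [F3 j h0 h1 h2, F3 (j + 1) h3 (by omega) (by omega)]; simp
  · intro m; exact (LinearMap.congr_fun F0 m).trans (hA m)
  · intro m; exact (LinearMap.congr_fun F1 m).trans (hB m)
  · intro m; exact (LinearMap.congr_fun F2 m).trans (hC m)
  · exact F3

/-- `M` is the projective-injective at vertex `q+1`, generated by `x`. -/
def IsP (M : QRep k n) (q : ℕ) (x : Fin (M.d (q + 1)) → k) : Prop :=
  M.β q (M.α q x) ≠ 0 ∧
  (∀ m, ∃ a b : k, m = a • x + b • M.β q (M.α q x)) ∧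
  (∀ m, ∃ a : k, m = a • M.α q x) ∧
  (∀ m, ∃ a : k, m = a • M.β (q + 1) x) ∧
  (∀ j, j ≠ q → j ≠ q + 1 → j ≠ q + 2 → M.d j = 0)

theorem exists_psi (M : QRep k n) (q : ℕ) (x : Fin (M.d (q + 1)) → k)
    (h : M.β q (M.α q x) ≠ 0) :
    ∃ ψ : (Fin (M.d (q + 1)) → k) →ₗ[k] k, ψ x = 0 ∧ ψ (M.β q (M.α q x)) = 1 := by
  obtain ⟨f, hf⟩ := Module.Projective.exists_dual_eq_one k h
  refine ⟨f - f x • (f ∘ₗ M.β q ∘ₗ M.α q), ?_, ?_⟩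
  · simp [hf]
  · simp [hf, aba]

theorem IsP.beta {M : QRep k n} {q : ℕ} {x : Fin (M.d (q + 1)) → k}
    (ψ : (Fin (M.d (q + 1)) → k) →ₗ[k] k) (h : ψ (M.β q (M.α q x)) = 1) {N : QRep k n}
    (x' : Fin (N.d (q + 1)) → k) :
    ψ (M.α (q + 1) (M.β (q + 1) x)) • N.β (q + 1) x' = N.β (q + 1) x' := by
  by_cases hq : q + 2 ≤ n
  · rw [cm M q hq, h, one_smul]
  · exact (vec_zero (N.hd (q + 1 + 1) (by omega)) _).trans
          (vec_zero (N.hd (q + 1 + 1) (by omega)) _).symm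

theorem IsP.surj {M N : QRep k n} {q : ℕ} {x : Fin (M.d (q + 1)) → k}
    {x' : Fin (N.d (q + 1)) → k} (hM : IsP M q x) (hN : IsP N q x') :
    ∃ φ : RepHom M N, ∀ i, Function.Surjective (φ.f i) := by
  obtain ⟨ψ, hx, hy⟩ := exists_psi M q x hM.1
  obtain ⟨φ, h0, h1, h2, h3⟩ := exists_hom M N q ψ x'
  refine ⟨φ, fun i m => ?_⟩
  by_cases i0 : i = q
  · subst i0
    obtain ⟨a, rfl⟩ := hN.2.2.1 m
    exact ⟨a • M.α i x, by rw [map_smul, h0, hy, one_smul]⟩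
  by_cases i1 : i = q + 1
  · subst i1
    obtain ⟨a, b, rfl⟩ := hN.2.1 m
    refine ⟨a • x + b • M.β q (M.α q x), ?_⟩
    rw [map_add, map_smul, map_smul, h1, h1, hx, hy, aba]
    simp
  by_cases i2 : i = q + 2
  · subst i2
    obtain ⟨a, rfl⟩ := hN.2.2.2.1 m
    exact ⟨a • M.β (q + 1) x, by rw [map_smul, h2, IsP.beta ψ hy]⟩
  exact ⟨0, (vec_zero (hN.2.2.2.2 i i0 i1 i2) _).trans (vec_zero (hN.2.2.2.2 i i0 i1 i2) _).symm⟩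

theorem IsP.iso {M N : QRep k n} {q : ℕ} {x : Fin (M.d (q + 1)) → k}
    {x' : Fin (N.d (q + 1)) → k} (hM : IsP M q x) (hN : IsP N q x') : RepIso M N := by
  obtain ⟨φ, hφ⟩ := hM.surj hN
  obtain ⟨χ, hχ⟩ := hN.surj hM
  refine ⟨φ, fun i => ⟨?_, hφ i⟩⟩
  have e1 := LinearMap.finrank_le_finrank_of_surjective (hφ i)
  have e2 := LinearMap.finrank_le_finrank_of_surjective (hχ i)
  exact (LinearMap.injective_iff_surjective_of_finrank_eq_finrank (le_antisymm e2 e1)).2 (hφ i)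

theorem IsP.indec {M : QRep k n} {q : ℕ} {x : Fin (M.d (q + 1)) → k} (hM : IsP M q x) :
    Indec M := by
  obtain ⟨hne, hs1, hs0, hs2, hs3⟩ := hM
  refine ⟨⟨q + 1, fun h => hne (vec_zero h _)⟩, fun e he => ?_⟩
  obtain ⟨ψ, hx, hy⟩ := exists_psi M q x hne
  obtain ⟨a, b, hab⟩ := hs1 (e.f (q + 1) x)
  have cα : ∀ i m, e.f i (M.α i m) = M.α i (e.f (i + 1) m) := fun i m =>
    LinearMap.congr_fun (e.commα i) m
  have cβ : ∀ i m, e.f (i + 1) (M.β i m) = M.β i (e.f i m) := fun i m =>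
    LinearMap.congr_fun (e.commβ i) m
  have hey : e.f (q + 1) (M.β q (M.α q x)) = a • M.β q (M.α q x) := by
    rw [cβ, cα, hab]; simp [aba]
  have hee : e.f (q + 1) (e.f (q + 1) x) = e.f (q + 1) x :=
    LinearMap.congr_fun (he (q + 1)) x
  rw [hab, map_add, map_smul, map_smul, hab, hey] at hee
  have ha : a * a = a := by
    have := congrArg (fun m => ψ (M.β q (M.α q m))) hee
    simpa [aba, hy] using this
  have hb : a * b + b * a = b := by
    have := congrArg ψ hee
    simpa [hx, hy] using this
  have key : ∀ i m, e.f i m = a • m := by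
    have ha' : a = 0 ∨ a = 1 := by
      rcases eq_or_ne a 0 with h | h
      · exact Or.inl h
      · exact Or.inr (mul_left_cancel₀ h (by rw [ha, mul_one]))
    have hb0 : b = 0 := by
      rcases ha' with rfl | rfl
      · simpa using hb.symm
      · linear_combination hb
    have hex : e.f (q + 1) x = a • x := by rw [hab, hb0]; simp
    intro i m
    by_cases i0 : i = q
    · subst i0
      obtain ⟨c, rfl⟩ := hs0 m
      rw [map_smul, cα, hex, map_smul, smul_comm]
    by_cases i1 : i = q + 1
    · subst i1
      obtain ⟨c, d, rfl⟩ := hs1 m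
      rw [map_add, map_smul, map_smul, hey, hex, smul_add, smul_comm, smul_comm a d]
    by_cases i2 : i = q + 2
    · subst i2
      obtain ⟨c, rfl⟩ := hs2 m
      rw [map_smul, cβ, hex, map_smul, smul_comm]
    exact (vec_zero (hs3 i i0 i1 i2) _).trans (vec_zero (hs3 i i0 i1 i2) _).symm
  rcases eq_or_ne a 0 with h | h
  · left; intro i; refine LinearMap.ext fun m => ?_; rw [key, h]; simp
  · have h1 : a = 1 := mul_left_cancel₀ h (by rw [ha, mul_one])
    right; intro i; refine LinearMap.ext fun m => ?_; rw [key, h1]; simp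

theorem isP_of_indec {M : QRep k n} (hM : Indec M) (q : ℕ) (x : Fin (M.d (q + 1)) → k)
    (h : M.β q (M.α q x) ≠ 0) : IsP M q x := by
  obtain ⟨ψ, hx, hy⟩ := exists_psi M q x h
  obtain ⟨φ, h0, h1, h2, h3⟩ := exists_hom M M q ψ x
  have hid : ∀ i, φ.f i = LinearMap.id := by
    refine (hM.2 φ fun i => ?_).resolve_left fun h => ?_
    · refine LinearMap.ext fun m => ?_
      rw [LinearMap.comp_apply]
      by_cases i0 : i = q
      · subst i0
        rw [h0 m, map_smul, h0, hy, one_smul]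
      by_cases i1 : i = q + 1
      · subst i1
        rw [h1 m, map_add, map_smul, map_smul, h1, h1, hx, hy, aba]
        simp
      by_cases i2 : i = q + 2
      · subst i2
        rw [h2 m, map_smul, h2, IsP.beta ψ hy]
      rw [h3 i i0 i1 i2]; simp
    · have := h1 x
      rw [h (q + 1), hx, hy] at this
      simp only [LinearMap.zero_apply, one_smul, zero_smul, add_zero] at this
      rw [← this] at hy
      simp at hy
  refine ⟨h, fun m => ?_, fun m => ?_, fun m => ?_, fun j j0 j1 j2 => ?_⟩
  · have := h1 m
    rw [hid] at this
    exact ⟨_, _, this⟩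
  · have := h0 m
    rw [hid] at this
    exact ⟨_, this⟩
  · have := h2 m
    rw [hid] at this
    exact ⟨_, this⟩
  · have e := h3 j j0 j1 j2
    rw [hid] at e
    by_contra hj
    have := congrFun (LinearMap.congr_fun e (fun _ => 1)) ⟨0, Nat.pos_of_ne_zero hj⟩
    simp at this

/-! ### Models -/

/-- The linear map given by a matrix with entries indexed by natural numbers. -/
def mk {m m' : ℕ} (A : ℕ → ℕ → k) : (Fin m → k) →ₗ[k] (Fin m' → k) :=
  Matrix.mulVecLin (Matrix.of fun t s => A t s)

theorem mk_apply {m m' : ℕ} (A : ℕ → ℕ → k) (f : Fin m → k) (t : Fin m') :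
    mk A f t = ∑ s : Fin m, A t s * f s := rfl

theorem mk_comp {m m' m'' : ℕ} (A B : ℕ → ℕ → k) :
    (mk A : (Fin m' → k) →ₗ[k] (Fin m'' → k)).comp (mk B : (Fin m → k) →ₗ[k] (Fin m' → k)) =
      mk (fun t s => ∑ u ∈ Finset.range m', A t u * B u s) := by
  refine LinearMap.ext fun f => funext fun t => ?_
  simp only [LinearMap.comp_apply, mk_apply, Finset.mul_sum, Finset.sum_mul]
  rw [Finset.sum_comm]
  refine Finset.sum_congr rfl fun s _ => ?_
  rw [← Fin.sum_univ_eq_sum_range (fun u => A t u * B u s * f s)]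
  exact Finset.sum_congr rfl fun u _ => (mul_assoc _ _ _).symm

theorem mk_zero {m m' : ℕ} {A : ℕ → ℕ → k} (h : ∀ t s, A t s = 0) :
    (mk A : (Fin m → k) →ₗ[k] (Fin m' → k)) = 0 := by
  refine LinearMap.ext fun f => funext fun t => ?_
  simp [mk_apply, h]

theorem ite_mul_zero' {p q : Prop} [Decidable p] [Decidable q] (h : ¬ (p ∧ q)) :
    (if p then (1 : k) else 0) * (if q then 1 else 0) = 0 := by
  by_cases hp : p <;> by_cases hq : q <;> simp_all

/-- The string module supported on `[a,b]`, the tops being the vertices congruent to `p`. -/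
def S (k : Type*) [Field k] (n a b p : ℕ) (hb : b ≤ n) : QRep k n where
  d j := if a ≤ j ∧ j ≤ b then 1 else 0
  hd i hi := by rw [if_neg]; omega
  α j := mk (fun _ _ => if (j + 1) % 2 = p % 2 then 1 else 0)
  β j := mk (fun _ _ => if j % 2 = p % 2 then 1 else 0)
  rel_comm i _ := by
    rw [mk_comp, mk_comp, mk_zero, mk_zero] <;>
    exact fun t s => Finset.sum_eq_zero fun u _ => ite_mul_zero' (by omega)
  rel_aa i _ := by
    rw [mk_comp, mk_zero]
    exact fun t s => Finset.sum_eq_zero fun u _ => ite_mul_zero' (by omega)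
  rel_bb i _ := by
    rw [mk_comp, mk_zero]
    exact fun t s => Finset.sum_eq_zero fun u _ => ite_mul_zero' (by omega)
  rel_ab := by
    rw [mk_comp, mk_zero]
    exact fun t s => Finset.sum_eq_zero fun u _ => ite_mul_zero' (by omega)

/-- The projective-injective at `q+1`. -/
def P (k : Type*) [Field k] (n q : ℕ) (hq : q + 1 ≤ n) : QRep k n where
  d j := if j = q + 1 then 2 else if j = q ∨ (j = q + 2 ∧ j ≤ n) then 1 else 0
  hd i hi := by rw [if_neg, if_neg] <;> omega
  α j := mk (fun t s => if (j = q ∧ s = 0) ∨ (j = q + 1 ∧ t = 1) then 1 else 0)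
  β j := mk (fun t s => if (j = q ∧ t = 1) ∨ (j = q + 1 ∧ s = 0) then 1 else 0)
  rel_comm i hi := by
    rw [mk_comp, mk_comp]
    by_cases h : i = q
    · subst h
      congr 1
      funext t s
      rw [if_neg (by omega), if_pos (by omega), if_neg (by omega), if_pos (by omega)]
      simp only [Finset.sum_range_one]
      by_cases ht : t = 1 <;> by_cases hs : s = 0 <;> simp [ht, hs]
    · rw [mk_zero, mk_zero] <;>
      exact fun t s => Finset.sum_eq_zero fun u _ => ite_mul_zero' (by omega)
  rel_aa i _ := by
    rw [mk_comp, mk_zero]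
    exact fun t s => Finset.sum_eq_zero fun u _ => ite_mul_zero' (by omega)
  rel_bb i _ := by
    rw [mk_comp, mk_zero]
    exact fun t s => Finset.sum_eq_zero fun u _ => ite_mul_zero' (by omega)
  rel_ab := by
    rw [mk_comp, mk_zero]
    exact fun t s => Finset.sum_eq_zero fun u _ => ite_mul_zero' (by omega)

theorem vec_one {m : ℕ} (h : m ≤ 1) (f : Fin m → k) : ∃ a : k, ∀ t, f t = a := by
  interval_cases m
  · exact ⟨0, fun t => t.elim0⟩
  · exact ⟨f 0, fun t => by rw [Subsingleton.elim t 0]⟩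

theorem vec_two {m : ℕ} (h : m = 2) (f : Fin m → k) :
    ∃ a b : k, ∀ t, f t = if (t : ℕ) = 0 then a else b := by
  subst h
  exact ⟨f 0, f 1, fun t => by fin_cases t <;> simp⟩

theorem sum_fin_two {m : ℕ} (h : m = 2) (g : ℕ → k) : ∑ s : Fin m, g s = g 0 + g 1 := by
  subst h; simp

theorem sum_fin_one {m : ℕ} (h : m = 1) (g : ℕ → k) : ∑ s : Fin m, g s = g 0 := by
  subst h; simp

theorem P_isP (q : ℕ) (hq : q + 1 ≤ n) :
    IsP (P k n q hq) q (fun s => if (s : ℕ) = 0 then 1 else 0) := by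
  have d0 : (P k n q hq).d q = 1 := by simp [P]
  have d1 : (P k n q hq).d (q + 1) = 2 := by simp [P]
  have d2 : (P k n q hq).d (q + 2) ≤ 1 := by simp only [P]; split_ifs <;> omega
  have d3 : ∀ j, j ≠ q → j ≠ q + 1 → j ≠ q + 2 → (P k n q hq).d j = 0 := by
    intro j h0 h1 h2
    simp only [P]; rw [if_neg, if_neg] <;> omega
  have e1 : (P k n q hq).α q (fun s => if (s : ℕ) = 0 then 1 else 0) = fun _ => 1 := by
    funext t
    refine (sum_fin_two d1 (fun s => (if (q = q ∧ s = 0) ∨ (q = q + 1 ∧ (t : ℕ) = 1) then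
      (1 : k) else 0) * (if s = 0 then 1 else 0))).trans ?_
    simp
  have e2 : (P k n q hq).β q (fun _ => 1) =
      fun t : Fin ((P k n q hq).d (q + 1)) => if (t : ℕ) = 1 then (1 : k) else 0 := by
    funext t
    refine (sum_fin_one d0 (fun s => (if (q = q ∧ (t : ℕ) = 1) ∨ (q = q + 1 ∧ s = 0) then
      (1 : k) else 0) * 1)).trans ?_
    simp
  have e3 : (P k n q hq).β (q + 1) (fun s => if (s : ℕ) = 0 then 1 else 0) = fun _ => 1 := by
    funext t
    refine (sum_fin_two d1 (fun s => (if (q + 1 = q ∧ (t : ℕ) = 1) ∨ (q + 1 = q + 1 ∧ s = 0) then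
      (1 : k) else 0) * (if s = 0 then 1 else 0))).trans ?_
    simp
  refine ⟨?_, ?_, ?_, ?_, d3⟩
  · rw [e1, e2]
    intro h
    have := congrFun h ⟨1, by omega⟩
    simp at this
  · rw [e1, e2]
    intro m
    obtain ⟨a, b, h⟩ := vec_two d1 m
    refine ⟨a, b, funext fun t => ?_⟩
    have := t.2
    rw [h t]
    by_cases ht : (t : ℕ) = 0
    · simp [ht]
    · have : (t : ℕ) = 1 := by omega
      simp [this]
  · rw [e1]
    intro m
    obtain ⟨a, h⟩ := vec_one d0.le m
    exact ⟨a, funext fun t => by simp [h]⟩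
  · rw [e3]
    intro m
    obtain ⟨a, h⟩ := vec_one d2 m
    exact ⟨a, funext fun t => by simp [h]⟩

theorem S_congr (a b p p' : ℕ) (hb : b ≤ n) (h : p % 2 = p' % 2 ∨ a = b) :
    S k n a b p hb = S k n a b p' hb := by
  rcases h with h | h
  · simp only [S, h]
  · subst h
    have : ∀ j, ((if a ≤ j ∧ j ≤ a then 1 else 0) = 0) ∨
        ((if a ≤ j + 1 ∧ j + 1 ≤ a then 1 else 0) = 0) := by
      intro j; split_ifs <;> omega
    unfold S
    congr 1
    · funext j
      refine LinearMap.ext fun m => ?_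
      rcases this j with h | h
      · exact (vec_zero h _).trans (vec_zero h _).symm
      · rw [vec_zero h m, map_zero, map_zero]
    · funext j
      refine LinearMap.ext fun m => ?_
      rcases this j with h | h
      · rw [vec_zero h m, map_zero, map_zero]
      · exact (vec_zero h _).trans (vec_zero h _).symm

theorem end_one {m : ℕ} (hm : m ≤ 1) (g : (Fin m → k) →ₗ[k] (Fin m → k)) :
    ∃ c : k, ∀ f, g f = c • f := by
  interval_cases m
  · exact ⟨0, fun f => Subsingleton.elim _ _⟩
  · refine ⟨g (fun _ => 1) 0, fun f => ?_⟩
    have : f = f 0 • (fun _ => 1) := by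
      funext t; rw [Subsingleton.elim t 0]; simp
    conv_lhs => rw [this, map_smul]
    funext t; rw [Subsingleton.elim t 0]; simp [mul_comm]

theorem S_d (a b p j : ℕ) (hb : b ≤ n) :
    (S k n a b p hb).d j = if a ≤ j ∧ j ≤ b then 1 else 0 := rfl

theorem S_d_one {a b p j : ℕ} {hb : b ≤ n} (h : a ≤ j ∧ j ≤ b) :
    (S k n a b p hb).d j = 1 := by rw [S_d, if_pos h]

theorem S_d_zero {a b p j : ℕ} {hb : b ≤ n} (h : ¬ (a ≤ j ∧ j ≤ b)) :
    (S k n a b p hb).d j = 0 := by rw [S_d, if_neg h]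

theorem S_β_apply (a b p j : ℕ) (hb : b ≤ n) (h : a ≤ j ∧ j ≤ b) (c : k) :
    (S k n a b p hb).β j (fun _ => c) = fun _ => if j % 2 = p % 2 then c else 0 := by
  funext t
  refine (sum_fin_one (S_d_one (k := k) (n := n) (p := p) (hb := hb) h) (fun _ => (if j % 2 = p % 2 then (1 : k) else 0) * c)).trans ?_
  simp

theorem S_α_apply (a b p j : ℕ) (hb : b ≤ n) (h : a ≤ j + 1 ∧ j + 1 ≤ b) (c : k) :
    (S k n a b p hb).α j (fun _ => c) = fun _ => if (j + 1) % 2 = p % 2 then c else 0 := by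
  funext t
  refine (sum_fin_one (S_d_one (k := k) (n := n) (p := p) (hb := hb) h)
    (fun _ => (if (j + 1) % 2 = p % 2 then (1 : k) else 0) * c)).trans ?_
  simp

theorem const_inj {m : ℕ} (h : m = 1) {c c' : k} (e : (fun _ : Fin m => c) = fun _ => c') :
    c = c' := congrFun e ⟨0, by omega⟩

theorem S_indec (a b p : ℕ) (hab : a ≤ b) (hb : b ≤ n) : Indec (S k n a b p hb) := by
  refine ⟨⟨a, by rw [S_d_one ⟨le_rfl, hab⟩]; exact one_ne_zero⟩, fun e he => ?_⟩
  have hle : ∀ j, (S k n a b p hb).d j ≤ 1 := by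
    intro j; rw [S_d]; split_ifs <;> omega
  choose c hc using fun j => end_one (hle j) (e.f j)
  have step : ∀ j, a ≤ j → j + 1 ≤ b → c (j + 1) = c j := by
    intro j h1 h2
    by_cases hj : j % 2 = p % 2
    · have := LinearMap.congr_fun (e.commβ j) (fun _ => 1)
      simp only [LinearMap.comp_apply] at this
      rw [hc, hc, map_smul, S_β_apply a b p j hb ⟨h1, by omega⟩, if_pos hj] at this
      have := congrFun this ⟨0, by rw [S_d_one ⟨by omega, h2⟩]; omega⟩
      simpa using this
    · have := LinearMap.congr_fun (e.commα j) (fun _ => 1)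
      simp only [LinearMap.comp_apply] at this
      rw [hc, hc, map_smul, S_α_apply a b p j hb ⟨by omega, h2⟩, if_pos (by omega)] at this
      have := congrFun this ⟨0, by rw [S_d_one ⟨h1, by omega⟩]; omega⟩
      simpa using this.symm
  have all : ∀ j, a ≤ j → j ≤ b → c j = c a := by
    intro j hj
    induction j, hj using Nat.le_induction with
    | base => intro _; rfl
    | succ j hj ih => intro h; rw [step j hj h, ih (by omega)]
  have hca : c a * c a = c a := by
    have := LinearMap.congr_fun (he a) (fun _ => 1)
    rw [LinearMap.comp_apply, hc, hc] at this
    have := congrFun this ⟨0, by rw [S_d_one ⟨le_rfl, hab⟩]; omega⟩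
    simpa using this
  have key : ∀ j m, e.f j m = c a • m := by
    intro j m
    by_cases h : a ≤ j ∧ j ≤ b
    · rw [hc, all j h.1 h.2]
    · exact (vec_zero (S_d_zero h) _).trans (vec_zero (S_d_zero h) _).symm
  rcases eq_or_ne (c a) 0 with h | h
  · left; intro i; refine LinearMap.ext fun m => ?_; rw [key, h]; simp
  · have h1 : c a = 1 := mul_left_cancel₀ h (by rw [hca, mul_one])
    right; intro i; refine LinearMap.ext fun m => ?_; rw [key, h1]; simp

theorem S_noniso (a b p p' : ℕ) (hab : a < b) (hb : b ≤ n) (hp : a % 2 = p % 2)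
    (hp' : ¬ a % 2 = p' % 2) : ¬ RepIso (S k n a b p hb) (S k n a b p' hb) := by
  rintro ⟨φ, hφ⟩
  have h := LinearMap.congr_fun (φ.commβ a) (fun _ => 1)
  simp only [LinearMap.comp_apply] at h
  rw [S_β_apply a b p a hb ⟨le_rfl, by omega⟩, if_pos hp] at h
  obtain ⟨c, hc⟩ := vec_one (S_d_one (k := k) (n := n) (p := p') (hb := hb)
    (show a ≤ a ∧ a ≤ b by omega)).le (φ.f a (fun _ => 1))
  have hc' : φ.f a (fun _ => 1) = fun _ => c := funext hc
  rw [hc', S_β_apply a b p' a hb ⟨le_rfl, by omega⟩, if_neg hp'] at h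
  have : (fun _ => 1 : Fin ((S k n a b p hb).d (a + 1)) → k) = 0 :=
    (hφ (a + 1)).1 (h.trans (map_zero _).symm)
  have := const_inj (S_d_one (show a ≤ a + 1 ∧ a + 1 ≤ b by omega)) this
  exact one_ne_zero this

/-! ### Classification of the radical square zero representations -/

section zigzag

variable (M : QRep k n) (p : ℕ)

/-- The edge relation. -/
def E (j : ℕ) : Submodule k ((Fin (M.d j) → k) × (Fin (M.d (j + 1)) → k)) where
  carrier := {v | (j % 2 = p % 2 → v.2 = M.β j v.1) ∧ (¬ j % 2 = p % 2 → v.1 = M.α j v.2)}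
  zero_mem' := by simp
  add_mem' := by
    rintro v w ⟨h1, h2⟩ ⟨h3, h4⟩
    exact ⟨fun h => by simp [h1 h, h3 h], fun h => by simp [h2 h, h4 h]⟩
  smul_mem' := by
    rintro c v ⟨h1, h2⟩
    exact ⟨fun h => by simp [h1 h], fun h => by simp [h2 h]⟩

theorem mem_E (j : ℕ) (v w) : (v, w) ∈ E M p j ↔
    (j % 2 = p % 2 → w = M.β j v) ∧ (¬ j % 2 = p % 2 → v = M.α j w) := Iff.rfl

/-- Chains from `a` to `b`. -/
def Ch (a b : ℕ) : Submodule k (∀ j, Fin (M.d j) → k) where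
  carrier := {v | ∀ j, a ≤ j → j < b → (v j, v (j + 1)) ∈ E M p j}
  zero_mem' := fun j _ _ => (E M p j).zero_mem
  add_mem' := fun h1 h2 j ha hb => (E M p j).add_mem (h1 j ha hb) (h2 j ha hb)
  smul_mem' := fun c _ h1 j ha hb => (E M p j).smul_mem c (h1 j ha hb)

theorem mem_Ch (a b : ℕ) (v) : v ∈ Ch M p a b ↔
    ∀ j, a ≤ j → j < b → (v j, v (j + 1)) ∈ E M p j := Iff.rfl

theorem Ch_extend {a b : ℕ} {v} (hv : v ∈ Ch M p a b) {w}
    (h : (v b, w) ∈ E M p b) : Function.update v (b + 1) w ∈ Ch M p a (b + 1) := by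
  intro j ha hb
  by_cases hj : j = b
  · subst hj
    rw [Function.update_self, Function.update_of_ne (by omega)]
    exact h
  · rw [Function.update_of_ne (by omega), Function.update_of_ne (by omega)]
    exact hv j ha (by omega)

theorem Ch_mono {a b : ℕ} {v} (hv : v ∈ Ch M p a (b + 1)) : v ∈ Ch M p a b :=
  fun j ha hb => hv j ha (by omega)

theorem exists_factor {X W : Type*} [AddCommGroup X] [Module k X] [AddCommGroup W] [Module k W]
    (f : X →ₗ[k] W) (g : X →ₗ[k] k) (h : ∀ x, f x = 0 → g x = 0) :
    ∃ ψ : W →ₗ[k] k, ∀ x, ψ (f x) = g x := by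
  have : g ∈ LinearMap.range f.dualMap := by
    rw [LinearMap.range_dualMap_eq_dualAnnihilator_ker, Submodule.mem_dualAnnihilator]
    exact h
  obtain ⟨ψ, hψ⟩ := this
  exact ⟨ψ, fun x => LinearMap.congr_fun hψ x⟩

theorem functional_chain (a : ℕ) (φ : (Fin (M.d a) → k) →ₗ[k] k) (b : ℕ) (hab : a ≤ b) :
    ∀ (ψb : (Fin (M.d b) → k) →ₗ[k] k), (∀ v ∈ Ch M p a b, ψb (v b) = φ (v a)) →
    ∃ ψ : ∀ j, (Fin (M.d j) → k) →ₗ[k] k, ψ b = ψb ∧ ψ a = φ ∧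
      ∀ j, a ≤ j → j < b → ∀ v w, (v, w) ∈ E M p j → ψ j v = ψ (j + 1) w := by
  induction b, hab using Nat.le_induction with
  | base =>
    intro ψb h
    refine ⟨Function.update (fun _ => 0) a ψb, Function.update_self .., ?_,
      fun j h1 h2 => by omega⟩
    rw [Function.update_self]
    refine LinearMap.ext fun x => ?_
    have := h (Function.update 0 a x) (fun j h1 h2 => by omega)
    simpa using this
  | succ b hab ih =>
    intro ψb h
    obtain ⟨χ, hχ⟩ := exists_factor (X := Ch M p a b × E M p b)
      (LinearMap.coprod ((LinearMap.proj b) ∘ₗ (Ch M p a b).subtype)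
        ((LinearMap.fst k _ _) ∘ₗ (E M p b).subtype))
      (LinearMap.coprod (φ ∘ₗ (LinearMap.proj a) ∘ₗ (Ch M p a b).subtype)
        (ψb ∘ₗ (LinearMap.snd k _ _) ∘ₗ (E M p b).subtype)) (by
      rintro ⟨⟨v, hv⟩, ⟨⟨u, w⟩, hu⟩⟩ h0
      simp only [LinearMap.coprod_apply, LinearMap.comp_apply, Submodule.subtype_apply,
        LinearMap.proj_apply, LinearMap.fst_apply, LinearMap.snd_apply] at h0 ⊢
      have hvb : v b = -u := eq_neg_of_add_eq_zero_left h0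
      have hE : (v b, -w) ∈ E M p b := by
        rw [hvb]; exact (E M p b).neg_mem hu
      have := h _ (Ch_extend M p hv hE)
      rw [Function.update_self, Function.update_of_ne (by omega)] at this
      rw [← this]; simp)
    have hχ1 : ∀ v ∈ Ch M p a b, χ (v b) = φ (v a) := by
      intro v hv
      have := hχ (⟨v, hv⟩, 0)
      simpa using this
    have hχ2 : ∀ u w, (u, w) ∈ E M p b → χ u = ψb w := by
      intro u w hu
      have := hχ (0, ⟨(u, w), hu⟩)
      simpa using this
    obtain ⟨ψ, h1, h2, h3⟩ := ih χ hχ1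
    refine ⟨Function.update ψ (b + 1) ψb, Function.update_self .., ?_, ?_⟩
    · rw [Function.update_of_ne (by omega), h2]
    · intro j ja jb v w hvw
      by_cases hj : j = b
      · subst hj
        rw [Function.update_self, Function.update_of_ne (by omega), h1]
        exact hχ2 v w hvw
      · rw [Function.update_of_ne (by omega), Function.update_of_ne (by omega)]
        exact h3 j ja (by omega) v w hvw

/-- The combinatorial heart: an interval summand starting at `a`. -/
theorem exists_interval (a : ℕ) (ha : M.d a ≠ 0) :
    ∃ b, a ≤ b ∧ ∃ v ∈ Ch M p a b, ∃ ψ : ∀ j, (Fin (M.d j) → k) →ₗ[k] k,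
      (∀ j, a ≤ j → j < b → ∀ v w, (v, w) ∈ E M p j → ψ j v = ψ (j + 1) w) ∧
      ψ a (v a) = 1 ∧ (b % 2 = p % 2 → M.β b (v b) = 0) ∧
      (¬ b % 2 = p % 2 → ∀ w, ψ b (M.α b w) = 0) := by
  by_contra hcon
  have hTJ : ∀ b, a ≤ b → (∀ x, ∃ v ∈ Ch M p a b, v a = x) ∧
      (∀ v ∈ Ch M p a b, v b = 0 → v a = 0) := by
    intro b hab
    induction b, hab using Nat.le_induction with
    | base =>
      exact ⟨fun x => ⟨Function.update 0 a x, fun j h1 h2 => by omega, by simp⟩,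
        fun v _ h => h⟩
    | succ b hab ih =>
      obtain ⟨T, J⟩ := ih
      by_cases hb : b % 2 = p % 2
      · refine ⟨fun x => ?_, fun v hv h0 => ?_⟩
        · obtain ⟨v, hv, hx⟩ := T x
          refine ⟨_, Ch_extend M p hv (w := M.β b (v b)) ⟨fun _ => rfl, fun h => absurd hb h⟩, ?_⟩
          rw [Function.update_of_ne (by omega), hx]
        · by_contra hne
          apply hcon
          obtain ⟨φ, hφ⟩ := Module.Projective.exists_dual_eq_one k hne
          obtain ⟨χ, hχ⟩ := exists_factor (X := Ch M p a b)
            ((LinearMap.proj b) ∘ₗ (Ch M p a b).subtype)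
            (φ ∘ₗ (LinearMap.proj a) ∘ₗ (Ch M p a b).subtype) (by
              rintro ⟨u, hu⟩ hu0
              have : u a = 0 := J u hu hu0
              simp [this])
          obtain ⟨ψ, h1, h2, h3⟩ := functional_chain M p a φ b hab χ
            (fun u hu => hχ ⟨u, hu⟩)
          refine ⟨b, hab, v, Ch_mono M p hv, ψ, h3, by rw [h2, hφ], fun _ => ?_,
            fun h => absurd hb h⟩
          rw [← (hv b hab (by omega)).1 hb]; exact h0
      · refine ⟨fun x => ?_, fun v hv h0 => ?_⟩
        · by_contra hne
          apply hcon
          let T' : Submodule k (Fin (M.d a) → k) := (Ch M p a (b + 1)).map (LinearMap.proj a)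
          have hx : x ∉ T' := by
            rintro ⟨v, hv, hvx⟩
            exact hne ⟨v, hv, hvx⟩
          obtain ⟨φ₀, hφ0, hφT⟩ := Submodule.exists_le_ker_of_notMem hx
          obtain ⟨φ, hφ, hT'⟩ : ∃ φ : (Fin (M.d a) → k) →ₗ[k] k, φ x = 1 ∧
              ∀ y ∈ T', φ y = 0 := by
            refine ⟨(φ₀ x)⁻¹ • φ₀, ?_, fun y hy => ?_⟩
            · simp [inv_mul_cancel₀ hφ0]
            · have : φ₀ y = 0 := hφT hy
              simp [this]
          obtain ⟨χ, hχ⟩ := exists_factor (X := Ch M p a b × (Fin (M.d (b + 1)) → k))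
            (LinearMap.coprod ((LinearMap.proj b) ∘ₗ (Ch M p a b).subtype) (M.α b))
            (LinearMap.coprod (φ ∘ₗ (LinearMap.proj a) ∘ₗ (Ch M p a b).subtype) 0) (by
              rintro ⟨⟨u, hu⟩, w⟩ hu0
              simp only [LinearMap.coprod_apply, LinearMap.comp_apply, Submodule.subtype_apply,
                LinearMap.proj_apply] at hu0 ⊢
              have hub : u b = M.α b (-w) := by
                rw [map_neg]; exact eq_neg_of_add_eq_zero_left hu0
              have hmem := Ch_extend M p hu (w := -w) ⟨fun h => absurd h hb, fun _ => hub⟩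
              have : u a ∈ T' := ⟨_, hmem, by
                rw [LinearMap.proj_apply, Function.update_of_ne (by omega)]⟩
              rw [hT' _ this]; simp)
          obtain ⟨ψ, h1, h2, h3⟩ := functional_chain M p a φ b hab χ
            (fun u hu => by simpa using hχ (⟨u, hu⟩, 0))
          obtain ⟨v, hv, hvx⟩ := T x
          refine ⟨b, hab, v, hv, ψ, h3, by rw [h2, hvx, hφ], fun h => absurd h hb,
            fun _ w => ?_⟩
          rw [h1]
          simpa using hχ (0, w)
        · apply J v (Ch_mono M p hv)
          have := (hv b hab (by omega)).2 hb
          simp only at this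
          rw [this, h0, map_zero]
  have hle : a ≤ n := by
    by_contra h
    exact ha (M.hd a (by omega))
  obtain ⟨T, J⟩ := hTJ (n + 1) (by omega)
  obtain ⟨v, hv, hva⟩ := T (fun _ => 1)
  have := J v hv (vec_zero (M.hd (n + 1) (by omega)) _)
  rw [hva] at this
  have := congrFun this ⟨0, Nat.pos_of_ne_zero ha⟩
  simp at this

theorem iso_S_of_zigzag (hM : Indec M) (hβ : ∀ j, ¬ j % 2 = p % 2 → M.β j = 0)
    (hα : ∀ j, ¬ (j + 1) % 2 = p % 2 → M.α j = 0) :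
    ∃ a b, a ≤ b ∧ ∃ hb : b ≤ n, RepIso M (S k n a b p hb) := by
  classical
  have hex := hM.1
  let a := Nat.find hex
  have ha : M.d a ≠ 0 := Nat.find_spec hex
  have hmin : ∀ j, j < a → M.d j = 0 := fun j hj => by
    by_contra h; exact Nat.find_min hex hj h
  clear_value a
  obtain ⟨b, hab, v, hv, ψ, hψ, h1, hβb, hαb⟩ := exists_interval M p a ha
  have hone : ∀ j, a ≤ j → j ≤ b → ψ j (v j) = 1 := by
    intro j hj
    induction j, hj using Nat.le_induction with
    | base => intro _; exact h1
    | succ j hj ih =>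
      intro h
      rw [← hψ j hj (by omega) _ _ (hv j hj (by omega)), ih (by omega)]
  have Eα : ∀ j, (j + 1) % 2 = p % 2 → ∀ m, (M.α j m, m) ∈ E M p j := fun j hj m =>
    ⟨fun h => by omega, fun _ => rfl⟩
  have Eβ : ∀ j, j % 2 = p % 2 → ∀ m, (m, M.β j m) ∈ E M p j := fun j hj m =>
    ⟨fun _ => rfl, fun h => absurd hj h⟩
  let e : RepHom M M :=
    { f := fun j => if a ≤ j ∧ j ≤ b then (ψ j).smulRight (v j) else 0
      commα := by
        intro j
        by_cases hj : (j + 1) % 2 = p % 2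
        swap
        · rw [hα j hj]; simp
        refine LinearMap.ext fun m => ?_
        simp only [LinearMap.comp_apply]
        by_cases c1 : a ≤ j ∧ j ≤ b
        · rw [if_pos c1]
          by_cases c2 : j + 1 ≤ b
          · rw [if_pos ⟨by omega, c2⟩]
            simp only [LinearMap.smulRight_apply, map_smul]
            rw [hψ j c1.1 (by omega) _ _ (Eα j hj m)]
            have := (hv j c1.1 (by omega)).2 (by omega)
            simp only at this
            rw [← this]
          · have : j = b := by omega
            subst this
            rw [if_neg (by omega)]
            simp [hαb (by omega) m]
        · have : (if a ≤ j + 1 ∧ j + 1 ≤ b then (ψ (j + 1)).smulRight (v (j + 1)) else 0) m = 0 ∨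
              M.d j = 0 := by
            by_cases c2 : j < a
            · exact Or.inr (hmin j c2)
            · left; rw [if_neg (by omega)]; simp
          rcases this with h | h
          · rw [h, if_neg c1]; simp
          · exact (vec_zero h _).trans (vec_zero h _).symm
      commβ := by
        intro j
        by_cases hj : j % 2 = p % 2
        swap
        · rw [hβ j hj]; simp
        refine LinearMap.ext fun m => ?_
        simp only [LinearMap.comp_apply]
        by_cases c1 : a ≤ j ∧ j ≤ b
        · rw [if_pos c1]
          by_cases c2 : j + 1 ≤ b
          · rw [if_pos ⟨by omega, c2⟩]
            simp only [LinearMap.smulRight_apply, map_smul]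
            rw [← hψ j c1.1 (by omega) _ _ (Eβ j hj m)]
            have := (hv j c1.1 (by omega)).1 hj
            simp only at this
            rw [← this]
          · have : j = b := by omega
            subst this
            rw [if_neg (by omega)]
            simp [hβb hj]
        · by_cases c2 : j < a
          · rw [vec_zero (hmin j c2) m]; simp
          · rw [if_neg (by omega), if_neg c1]; simp }
  have he : ∀ j, e.f j = if a ≤ j ∧ j ≤ b then (ψ j).smulRight (v j) else 0 := fun _ => rfl
  clear_value e
  have hid : ∀ i, e.f i = LinearMap.id := by
    refine (hM.2 e fun j => ?_).resolve_left fun h => ?_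
    · refine LinearMap.ext fun m => ?_
      rw [LinearMap.comp_apply, he]
      by_cases c : a ≤ j ∧ j ≤ b
      · rw [if_pos c]; simp [hone j c.1 c.2]
      · rw [if_neg c]; simp
    · have h2 := LinearMap.congr_fun (h a) (v a)
      rw [he, if_pos ⟨le_rfl, hab⟩] at h2
      simp only [LinearMap.smulRight_apply, h1, one_smul, LinearMap.zero_apply] at h2
      rw [h2] at h1
      simp at h1
  have hin : ∀ j, a ≤ j → j ≤ b → ∀ m, m = ψ j m • v j := by
    intro j ja jb m
    have := LinearMap.congr_fun (hid j) m
    rw [he, if_pos ⟨ja, jb⟩] at this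
    exact this.symm
  have hout : ∀ j, ¬ (a ≤ j ∧ j ≤ b) → M.d j = 0 := by
    intro j hj
    have h2 := hid j
    rw [he, if_neg hj] at h2
    by_contra hne
    have := congrFun (LinearMap.congr_fun h2 (fun _ => 1)) ⟨0, Nat.pos_of_ne_zero hne⟩
    simp at this
  have hb : b ≤ n := by
    by_contra h
    have h2 := hone b hab le_rfl
    rw [vec_zero (M.hd b (by omega)) (v b)] at h2
    simp at h2
  let F : ∀ j, (Fin (M.d j) → k) →ₗ[k] (Fin ((S k n a b p hb).d j) → k) := fun j =>
    LinearMap.pi fun _ => ψ j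
  have hF : ∀ j m, F j m = fun _ => ψ j m := fun _ _ => rfl
  clear_value F
  refine ⟨a, b, hab, hb, ⟨F, fun j => ?_, fun j => ?_⟩, fun j => ?_⟩
  · refine LinearMap.ext fun m => ?_
    simp only [LinearMap.comp_apply]
    by_cases c2 : a ≤ j + 1 ∧ j + 1 ≤ b
    · rw [hF, hF, S_α_apply a b p j hb c2]
      by_cases c1 : a ≤ j
      · funext t
        by_cases hj : (j + 1) % 2 = p % 2
        · rw [if_pos hj, hψ j c1 (by omega) _ _ (Eα j hj m)]
        · rw [if_neg hj, hα j hj]; simp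
      · have h0 : (S k n a b p hb).d j = 0 := S_d_zero (by omega)
        exact (vec_zero h0 _).trans (vec_zero h0 _).symm
    · rw [vec_zero (hout _ c2) m]; simp
  · refine LinearMap.ext fun m => ?_
    simp only [LinearMap.comp_apply]
    by_cases c2 : a ≤ j ∧ j ≤ b
    · rw [hF, hF, S_β_apply a b p j hb c2]
      by_cases c1 : j + 1 ≤ b
      · funext t
        by_cases hj : j % 2 = p % 2
        · rw [if_pos hj, hψ j c2.1 (by omega) _ _ (Eβ j hj m)]
        · rw [if_neg hj, hβ j hj]; simp
      · have h0 : (S k n a b p hb).d (j + 1) = 0 := S_d_zero (by omega)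
        exact (vec_zero h0 _).trans (vec_zero h0 _).symm
    · rw [vec_zero (hout _ c2) m]; simp
  · by_cases c : a ≤ j ∧ j ≤ b
    · have h0 : (S k n a b p hb).d j = 1 := S_d_one c
      constructor
      · rw [← LinearMap.ker_eq_bot, LinearMap.ker_eq_bot']
        intro m hm
        change F j m = 0 at hm
        rw [hF] at hm
        have : ψ j m = 0 := const_inj h0 hm
        rw [hin j c.1 c.2 m, this, zero_smul]
      · intro w
        obtain ⟨x, hx⟩ := vec_one h0.le w
        refine ⟨x • v j, ?_⟩
        change F j _ = _
        rw [hF]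
        funext t
        rw [hx t, map_smul, hone j c.1 c.2]; simp
    · have h0 : (S k n a b p hb).d j = 0 := S_d_zero c
      constructor
      · intro x y _
        exact (vec_zero (hout j c) _).trans (vec_zero (hout j c) _).symm
      · intro y
        exact ⟨0, (vec_zero h0 _).trans (vec_zero h0 _).symm⟩

end zigzag

/-- An indecomposable radical square zero representation is concentrated on one parity. -/
theorem exists_parity (M : QRep k n) (hM : Indec M) (h : ∀ q x, M.β q (M.α q x) = 0) :
    ∃ p, (∀ j, ¬ j % 2 = p % 2 → M.β j = 0) ∧ (∀ j, ¬ (j + 1) % 2 = p % 2 → M.α j = 0) := by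
  have h' : ∀ q x, M.α q (M.β q x) = 0 := by
    intro q x
    cases q with
    | zero => exact LinearMap.congr_fun M.rel_ab x
    | succ q =>
      by_cases hq : q + 2 ≤ n
      · rw [cm M q hq, h]
      · rw [vec_zero (M.hd (q + 1 + 1) (by omega)) (M.β (q + 1) x), map_zero]
  -- the projections onto the radical-annihilated part
  have hK : ∀ j, ∃ π : (Fin (M.d j) → k) →ₗ[k] (Fin (M.d j) → k),
      (∀ m, M.β j (π m) = 0) ∧ (∀ i (e : i + 1 = j) m, M.α i (e ▸ (π m)) = 0) ∧
      (∀ m, M.β j m = 0 → (∀ i (e : i + 1 = j), M.α i (e ▸ m) = 0) → π m = m) := by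
    intro j
    cases j with
    | zero =>
      obtain ⟨f, hf⟩ := LinearMap.exists_leftInverse_of_injective
        (LinearMap.ker (M.β 0)).subtype (Submodule.ker_subtype _)
      refine ⟨(LinearMap.ker (M.β 0)).subtype ∘ₗ f, fun m => (f m).2, fun i e => by omega,
        fun m hm _ => ?_⟩
      exact congrArg Subtype.val (LinearMap.congr_fun hf ⟨m, hm⟩)
    | succ j =>
      obtain ⟨f, hf⟩ := LinearMap.exists_leftInverse_of_injective
        (LinearMap.ker (M.β (j + 1)) ⊓ LinearMap.ker (M.α j)).subtype (Submodule.ker_subtype _)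
      refine ⟨(LinearMap.ker (M.β (j + 1)) ⊓ LinearMap.ker (M.α j)).subtype ∘ₗ f,
        fun m => (f m).2.1, fun i e m => ?_, fun m hm hm' => ?_⟩
      · obtain rfl : i = j := by omega
        exact (f m).2.2
      · exact congrArg Subtype.val (LinearMap.congr_fun hf ⟨m, hm, hm' j rfl⟩)
  choose π hπβ hπα' hπid' using hK
  have hπα : ∀ i m, M.α i (π (i + 1) m) = 0 := fun i m => hπα' (i + 1) i rfl m
  have πβ : ∀ j m, π (j + 1) (M.β j m) = M.β j m := by
    intro j m
    refine hπid' _ _ (bb M j m) fun i e => ?_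
    obtain rfl : i = j := by omega
    exact h' i m
  have πα : ∀ j m, π j (M.α j m) = M.α j m := by
    intro j m
    refine hπid' _ _ (h j m) fun i e => ?_
    subst e
    exact aa M i m
  have ππ : ∀ j m, π j (π j m) = π j m := by
    intro j m
    exact hπid' _ _ (hπβ j m) fun i e => hπα' j i e m
  let e : RepHom M M :=
    { f := fun j => if j % 2 = 0 then π j else LinearMap.id - π j
      commα := by
        intro j
        refine LinearMap.ext fun m => ?_
        simp only [LinearMap.comp_apply]
        by_cases hj : j % 2 = 0
        · rw [if_pos hj, if_neg (by omega)]; simp [πα, hπα]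
        · rw [if_neg hj, if_pos (by omega)]; simp [πα, hπα]
      commβ := by
        intro j
        refine LinearMap.ext fun m => ?_
        simp only [LinearMap.comp_apply]
        by_cases hj : j % 2 = 0
        · rw [if_pos hj, if_neg (by omega)]; simp [πβ, hπβ]
        · rw [if_neg hj, if_pos (by omega)]; simp [πβ, hπβ] }
  have he : ∀ j, e.f j = if j % 2 = 0 then π j else LinearMap.id - π j := fun _ => rfl
  clear_value e
  rcases hM.2 e (fun j => by
    rw [he]
    refine LinearMap.ext fun m => ?_
    by_cases hj : j % 2 = 0
    · rw [if_pos hj]; simp [ππ]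
    · rw [if_neg hj]; simp [ππ]) with h0 | h0
  · -- even vertices are tops
    have hod : ∀ j, ¬ j % 2 = 0 → ∀ m, π j m = m := by
      intro j hj m
      have := LinearMap.congr_fun (h0 j) m
      rw [he, if_neg hj] at this
      simp only [LinearMap.sub_apply, LinearMap.id_apply, LinearMap.zero_apply] at this
      exact (sub_eq_zero.1 this).symm
    refine ⟨0, fun j hj => LinearMap.ext fun m => ?_, fun j hj => LinearMap.ext fun m => ?_⟩
    · rw [← hod j (by omega) m, hπβ]; simp
    · rw [← hod (j + 1) (by omega) m, hπα]; simp
  · have hev : ∀ j, j % 2 = 0 → ∀ m, π j m = m := by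
      intro j hj m
      have := LinearMap.congr_fun (h0 j) m
      rw [he, if_pos hj] at this
      simpa using this
    refine ⟨1, fun j hj => LinearMap.ext fun m => ?_, fun j hj => LinearMap.ext fun m => ?_⟩
    · rw [← hev j (by omega) m, hπβ]; simp
    · rw [← hev (j + 1) (by omega) m, hπα]; simp

/-! ### The list -/

/-- The list of indecomposables. -/
def Lst (k : Type*) [Field k] (n : ℕ) : Fin n ⊕ (Fin (n + 1) × Fin (n + 1)) → QRep k n
  | Sum.inl q => P k n q (by omega)
  | Sum.inr (a, b) => if (a : ℕ) ≤ b then S k n a b a (by omega) else S k n b a (b + 1) (by omega)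

theorem Lst_indec (x) : Indec (Lst k n x) := by
  rcases x with q | ⟨a, b⟩
  · exact (P_isP (q : ℕ) q.2).indec
  · simp only [Lst]
    split_ifs with h
    · exact S_indec _ _ _ h _
    · exact S_indec _ _ _ (by omega) _

theorem P_d (q : ℕ) (hq : q + 1 ≤ n) (j : ℕ) : (P k n q hq).d j =
    if j = q + 1 then 2 else if j = q ∨ (j = q + 2 ∧ j ≤ n) then 1 else 0 := rfl

theorem Lst_inr_d (a b : Fin (n + 1)) (j : ℕ) : (Lst k n (Sum.inr (a, b))).d j =
    if min (a : ℕ) b ≤ j ∧ j ≤ max (a : ℕ) b then 1 else 0 := by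
  simp only [Lst]
  split_ifs with h h2 h2 <;> first | rw [S_d_one (by omega)] | rw [S_d_zero (by omega)]

theorem RepIso.symm' {M N : QRep k n} (h : RepIso M N) : RepIso N M := by
  obtain ⟨φ, hφ⟩ := h
  let g := fun i => LinearEquiv.ofBijective (φ.f i) (hφ i)
  have hg : ∀ i m, φ.f i m = g i m := fun _ _ => rfl
  refine ⟨⟨fun i => (g i).symm.toLinearMap, fun i => ?_, fun i => ?_⟩,
    fun i => (g i).symm.bijective⟩
  · refine LinearMap.ext fun m => ?_
    obtain ⟨m, rfl⟩ := (g (i + 1)).surjective m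
    simp only [LinearMap.comp_apply, LinearEquiv.coe_coe, LinearEquiv.symm_apply_apply]
    rw [LinearEquiv.symm_apply_eq, ← hg, ← hg]
    exact (LinearMap.congr_fun (φ.commα i) m).symm
  · refine LinearMap.ext fun m => ?_
    obtain ⟨m, rfl⟩ := (g i).surjective m
    simp only [LinearMap.comp_apply, LinearEquiv.coe_coe, LinearEquiv.symm_apply_apply]
    rw [LinearEquiv.symm_apply_eq, ← hg, ← hg]
    exact (LinearMap.congr_fun (φ.commβ i) m).symm

theorem Lst_ne_aux (a b : Fin (n + 1)) (hab : a < b) :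
    ¬ RepIso (Lst k n (Sum.inr (a, b))) (Lst k n (Sum.inr (b, a))) := by
  have h' : (a : ℕ) < b := hab
  simp only [Lst]
  rw [if_pos h'.le, if_neg (by omega)]
  exact S_noniso _ _ _ _ h' _ rfl (by omega)

theorem Lst_inj (x y) (h : RepIso (Lst k n x) (Lst k n y)) : x = y := by
  have hd := iso_dim h
  rcases x with q | ⟨a, b⟩ <;> rcases y with q' | ⟨a', b'⟩
  · have := hd (q + 1)
    simp only [Lst, P_d, if_true] at this
    have : (q : ℕ) = q' := by
      by_contra hne
      rw [if_neg (by omega)] at this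
      split_ifs at this <;> omega
    rw [Fin.ext this]
  · have := hd (q + 1)
    rw [Lst_inr_d] at this
    simp only [Lst, P_d, if_true] at this
    split_ifs at this <;> omega
  · have := hd (q' + 1)
    rw [Lst_inr_d] at this
    simp only [Lst, P_d, if_true] at this
    split_ifs at this <;> omega
  · have h1 := hd (min (a : ℕ) b)
    have h2 := hd (max (a : ℕ) b)
    have h3 := hd (min (a' : ℕ) b')
    have h4 := hd (max (a' : ℕ) b')
    simp only [Lst_inr_d] at h1 h2 h3 h4
    rw [if_pos (by omega)] at h1 h2
    rw [eq_comm, if_pos (by omega)] at h3 h4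
    have c1 := by_contra fun hn => by rw [if_neg hn] at h1; omega
    have c2 := by_contra fun hn => by rw [if_neg hn] at h2; omega
    have c3 := by_contra fun hn => by rw [if_neg hn] at h3; omega
    have c4 := by_contra fun hn => by rw [if_neg hn] at h4; omega
    clear h1 h2 h3 h4 hd
    by_cases haa : (a : ℕ) = a'
    · have : (b : ℕ) = b' := by omega
      rw [Fin.ext haa, Fin.ext this]
    · have e1 : (a : ℕ) = b' := by omega
      have e2 : (b : ℕ) = a' := by omega
      obtain rfl := Fin.ext e1
      obtain rfl := Fin.ext e2
      exfalso
      rcases lt_or_ge a b with hlt | hge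
      · exact Lst_ne_aux _ _ hlt h
      · refine Lst_ne_aux _ _ ?_ (RepIso.symm' h)
        exact Fin.lt_def.2 (by have := Fin.le_def.1 hge; omega)

theorem Lst_surj (M : QRep k n) (hM : Indec M) : ∃ x, RepIso M (Lst k n x) := by
  by_cases h : ∀ q x, M.β q (M.α q x) = 0
  · obtain ⟨p, hβ, hα⟩ := exists_parity M hM h
    obtain ⟨a, b, hab, hb, hiso⟩ := iso_S_of_zigzag M p hM hβ hα
    by_cases hp : p % 2 = a % 2 ∨ a = b
    · refine ⟨Sum.inr (⟨a, by omega⟩, ⟨b, by omega⟩), ?_⟩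
      simp only [Lst]
      rw [if_pos hab, ← S_congr a b p a hb hp]
      exact hiso
    · refine ⟨Sum.inr (⟨b, by omega⟩, ⟨a, by omega⟩), ?_⟩
      simp only [Lst]
      rw [if_neg (by omega), ← S_congr a b p (a + 1) hb (by omega)]
      exact hiso
  · push Not at h
    obtain ⟨q, x, hx⟩ := h
    have hq : q + 1 ≤ n := by
      by_contra hc
      exact hx (vec_zero (M.hd (q + 1) (by omega)) _)
    exact ⟨Sum.inl ⟨q, hq⟩, (isP_of_indec hM q x hx).iso (P_isP q hq)⟩

end QRepAux

/-- over an algebraically closed field, the number of isomorphism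
classes of indecomposable `B(n)`-modules is `n + (n+1)²`; in particular `B(n)`
is of finite representation type.  Formally: there is a list of `n + (n+1)²`
pairwise non-isomorphic indecomposable representations of `(Q(n), I(n))` such
that every indecomposable representation is isomorphic to one of them. -/
theorem stmt_10 (k : Type*) [Field k] [IsAlgClosed k] (n : ℕ) (hn : 1 ≤ n) :
    ∃ L : Fin (n + (n + 1) ^ 2) → QRep k n,
      (∀ j, Indec (L j)) ∧
      (∀ j j', RepIso (L j) (L j') → j = j') ∧
      (∀ M : QRep k n, Indec M → ∃ j, RepIso M (L j)) := by
  have hc : Fintype.card (Fin n ⊕ (Fin (n + 1) × Fin (n + 1))) = n + (n + 1) ^ 2 := by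
    simp [sq]
  let e := (Fintype.equivFinOfCardEq hc).symm
  refine ⟨fun j => QRepAux.Lst k n (e j), fun j => QRepAux.Lst_indec _, fun j j' h => ?_,
    fun M hM => ?_⟩
  · exact e.injective (QRepAux.Lst_inj _ _ h)
  · obtain ⟨x, hx⟩ := QRepAux.Lst_surj M hM
    exact ⟨e.symm x, by simpa only [e.apply_symm_apply] using hx⟩
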